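/- arXiv:2411.04231 — 2 statements merged into one kernel-verified Lean document; each statement's English description precedes it below -/
import Mathlib

section
/- Let U be an open subset of EuclideanSpace ℝ (n+1), let F : EuclideanSpace ℝ (n+1) → ℝ be twice continuously differentiable on U with ∇F nonvanishing on U, set ρ(x) = ‖∇F(x)‖ and ξ(x) = ρ(x)⁻¹ • ∇F(x), and let ΔF(x) denote the Laplacian of F (the trace of the second derivative of F at x). Then for every x ∈ U, the divergence of ξ satisfies trace(fderiv ℝ ξ x) = ΔF(x)/ρ(x) − ⟪∇F(x), ∇ρ(x)⟫/ρ(x)². Equivalently, the quantity h(x) = −(1/n)·trace(fderiv ℝ ξ x) equals (⟪∇F(x), ∇ρ(x)⟫ − ρ(x)·ΔF(x))/(n·ρ(x)²). -/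
open scoped RealInnerProductSpace

open scoped Gradient

/-- The Leibniz rule for the divergence of a scalar multiple of a vector field. -/
theorem trace_fderiv_smul {E : Type*} [NormedAddCommGroup E] [NormedSpace ℝ E]
    [FiniteDimensional ℝ E] {c : E → ℝ} {v : E → E} {x : E}
    (hc : DifferentiableAt ℝ c x) (hv : DifferentiableAt ℝ v x) :
    LinearMap.trace ℝ E (fderiv ℝ (fun y => c y • v y) x).toLinearMap
      = c x * LinearMap.trace ℝ E (fderiv ℝ v x).toLinearMap + fderiv ℝ c x (v x) := by
  have h : (fderiv ℝ (fun y => c y • v y) x).toLinearMap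
      = c x • (fderiv ℝ v x).toLinearMap
        + (fderiv ℝ c x).toLinearMap.smulRight (v x) := by
    rw [fderiv_fun_smul hc hv]
    rfl
  rw [h, map_add, map_smul, LinearMap.trace_smulRight]
  simp

theorem ContDiffAt.differentiableAt_gradient {E : Type*} [NormedAddCommGroup E]
    [InnerProductSpace ℝ E] [CompleteSpace E] {f : E → ℝ} {x : E} (hf : ContDiffAt ℝ 2 f x) :
    DifferentiableAt ℝ (∇ f) x :=
  (InnerProductSpace.toDual ℝ E).symm.differentiable.differentiableAt.comp x
    ((hf.fderiv_right (m := 1) (by norm_num)).differentiableAt (by norm_num))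

/-- Cartan's formula for the mean curvature of a level hypersurface (Euclidean
case): for `F` of class `C²` on an open set `U ⊆ ℝ^{n+1}` with nonvanishing
gradient, setting `ρ = ‖∇F‖`, `ξ = ∇F/ρ` and `ΔF = trace (fderiv ℝ (∇F))`,
the divergence of `ξ` satisfies
`div ξ = ΔF/ρ − ⟪∇F, ∇ρ⟫/ρ²`, equivalently the mean curvature
`h = −(1/n)·div ξ` equals `(⟪∇F, ∇ρ⟫ − ρ·ΔF)/(n·ρ²)`. -/
theorem mean_curvature_of_level_set
    (n : ℕ) (U : Set (EuclideanSpace ℝ (Fin (n + 1)))) (hU : IsOpen U)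
    (F : EuclideanSpace ℝ (Fin (n + 1)) → ℝ) (hF : ContDiffOn ℝ 2 F U)
    (hgrad : ∀ x ∈ U, gradient F x ≠ 0)
    (ρ : EuclideanSpace ℝ (Fin (n + 1)) → ℝ)
    (hρ : ∀ x, ρ x = ‖gradient F x‖)
    (ξ : EuclideanSpace ℝ (Fin (n + 1)) → EuclideanSpace ℝ (Fin (n + 1)))
    (hξ : ∀ x, ξ x = (ρ x)⁻¹ • gradient F x)
    (lapF : EuclideanSpace ℝ (Fin (n + 1)) → ℝ)
    (hlap : ∀ x, lapF x = LinearMap.trace ℝ (EuclideanSpace ℝ (Fin (n + 1)))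
      (fderiv ℝ (gradient F) x).toLinearMap) :
    ∀ x ∈ U,
      (LinearMap.trace ℝ (EuclideanSpace ℝ (Fin (n + 1)))
          (fderiv ℝ ξ x).toLinearMap
        = lapF x / ρ x - ⟪gradient F x, gradient ρ x⟫ / (ρ x) ^ 2) ∧
      (-(1 / (n : ℝ)) * LinearMap.trace ℝ (EuclideanSpace ℝ (Fin (n + 1)))
          (fderiv ℝ ξ x).toLinearMap
        = (⟪gradient F x, gradient ρ x⟫ - ρ x * lapF x) / ((n : ℝ) * (ρ x) ^ 2)) := by
  intro x hx
  have hv : DifferentiableAt ℝ (∇ F) x :=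
    (hF.contDiffAt (hU.mem_nhds hx)).differentiableAt_gradient
  have hρx : ρ x ≠ 0 := by
    rw [hρ]
    exact norm_ne_zero_iff.mpr (hgrad x hx)
  have hρd : DifferentiableAt ℝ ρ x := by
    rw [funext hρ]
    exact hv.norm ℝ (hgrad x hx)
  have hdiv : LinearMap.trace ℝ (EuclideanSpace ℝ (Fin (n + 1))) (fderiv ℝ ξ x).toLinearMap
      = lapF x / ρ x - ⟪∇ F x, ∇ ρ x⟫ / ρ x ^ 2 := by
    have hinv : HasFDerivAt (fun y => (ρ y)⁻¹) (-(ρ x ^ 2)⁻¹ • fderiv ℝ ρ x) x :=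
      (hasDerivAt_inv hρx).comp_hasFDerivAt x hρd.hasFDerivAt
    rw [funext hξ, trace_fderiv_smul hinv.differentiableAt hv, hinv.fderiv, ← hlap,
      inner_gradient_right]
    simp only [smul_apply, smul_eq_mul, conj_trivial]
    ring
  refine ⟨hdiv, ?_⟩
  rw [hdiv]
  rcases eq_or_ne (n : ℝ) 0 with hn | hn
  · simp [hn]
  · field_simp
    ring
end

section
/- Let E be a real inner product space, let g ≥ 1 be a natural number, and let F : E → ℝ be differentiable, homogeneous of degree g (F(t • x) = t^g · F(x) for all t ∈ ℝ, x ∈ E), and satisfy ‖∇F(x)‖² = g²·‖x‖^{2g−2} for all x ∈ E. Then |F(x)| ≤ 1 for every x ∈ E with ‖x‖ = 1. -/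
open scoped InnerProductSpace in
/-- Euler's relation for a differentiable homogeneous function of degree `g`. -/
theorem inner_gradient_self_of_homogeneous
    {E : Type*} [NormedAddCommGroup E] [InnerProductSpace ℝ E] [CompleteSpace E]
    {g : ℕ} {F : E → ℝ} {x : E} (hF : DifferentiableAt ℝ F x)
    (hhom : ∀ t : ℝ, F (t • x) = t ^ g * F x) :
    ⟪gradient F x, x⟫_ℝ = g * F x := by
  have hline : HasDerivAt (fun t : ℝ => t • x) x 1 := by
    simpa using (hasDerivAt_id (1 : ℝ)).smul_const x
  have hcomp : HasDerivAt (fun t : ℝ => F (t • x)) (fderiv ℝ F x x) 1 :=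
    HasFDerivAt.comp_hasDerivAt (f := fun t : ℝ => t • x) 1
      (by simpa using hF.hasFDerivAt) hline
  have hpow : HasDerivAt (fun t : ℝ => F (t • x)) (g * F x) 1 := by
    simp only [hhom]
    simpa using (hasDerivAt_pow g (1 : ℝ)).mul_const (F x)
  rw [gradient, InnerProductSpace.toDual_symm_apply]
  exact hcomp.unique hpow

/-- Münzner's observation: the restriction to the unit sphere of a function `F`
that is differentiable, homogeneous of degree `g ≥ 1`, and satisfies the first
Cartan–Münzner equation `‖∇F(x)‖² = g²‖x‖^{2g−2}` has range contained in
`[−1, 1]`. -/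
theorem cartan_muenzner_range_le_one
    {E : Type*} [NormedAddCommGroup E] [InnerProductSpace ℝ E] [CompleteSpace E]
    (g : ℕ) (hg : 1 ≤ g) (F : E → ℝ) (hF : Differentiable ℝ F)
    (hhom : ∀ (t : ℝ) (x : E), F (t • x) = t ^ g * F x)
    (hCM : ∀ x : E, ‖gradient F x‖ ^ 2 = (g : ℝ) ^ 2 * ‖x‖ ^ (2 * g - 2)) :
    ∀ x : E, ‖x‖ = 1 → |F x| ≤ 1 := by
  intro x hx
  have hg' : (0 : ℝ) < g := by exact_mod_cast hg
  have hnorm : ‖gradient F x‖ = g := by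
    have h := hCM x
    rw [hx, one_pow, mul_one] at h
    exact (pow_left_inj₀ (norm_nonneg _) hg'.le two_ne_zero).mp h
  have h := abs_real_inner_le_norm (gradient F x) x
  rw [inner_gradient_self_of_homogeneous (hF x) (hhom · x), hnorm, hx, abs_mul,
    abs_of_pos hg'] at h
  exact le_of_mul_le_mul_left h hg'
end
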